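/- Let X be a complex Banach space, let {S_h}, {T_h} be two bounded families of operators on X that are asymptotically quasinilpotent equivalent, and let {A_h} be a bounded family of operators such that lim_{h→0} ‖S_h A_h − A_h S_h‖ = 0 and lim_{h→0} ‖T_h A_h − A_h T_h‖ = 0. Then the families {S_h A_h} and {T_h A_h} are asymptotically quasinilpotent equivalent. -/

import Mathlib

open Filter Topology Finset

noncomputable section

/-- The filter of approach `h → 0` within the interval `(0,1]`. -/
def zeroFilter : Filter ℝ := nhdsWithin 0 (Set.Ioc 0 1)

variable {X : Type*} [NormedAddCommGroup X] [NormedSpace ℂ X]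

/-- A family of operators `(0,1] ∋ h ↦ S h` is bounded if `sup_{h ∈ (0,1]} ‖S h‖ < ∞`. -/
def BddFamily (S : ℝ → X →L[ℂ] X) : Prop :=
  ∃ M : ℝ, ∀ h ∈ Set.Ioc (0 : ℝ) 1, ‖S h‖ ≤ M

/-- The bracket `(T - S)^{[n]} = ∑_{k=0}^{n} (-1)^{n-k} C(n,k) T^k S^{n-k}`. -/
def qBr (T S : X →L[ℂ] X) (n : ℕ) : X →L[ℂ] X :=
  ∑ k ∈ Finset.range (n + 1), ((-1 : ℂ) ^ (n - k) * (n.choose k : ℂ)) • (T ^ k * S ^ (n - k))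

/-- Two families are asymptotically quasinilpotent equivalent. -/
def AsympQNEquiv (S T : ℝ → X →L[ℂ] X) : Prop :=
  Tendsto (fun n : ℕ =>
      (Filter.limsup (fun h => ‖qBr (S h) (T h) n‖) zeroFilter) ^ ((n : ℝ)⁻¹))
    atTop (𝓝 0) ∧
  Tendsto (fun n : ℕ =>
      (Filter.limsup (fun h => ‖qBr (T h) (S h) n‖) zeroFilter) ^ ((n : ℝ)⁻¹))
    atTop (𝓝 0)

/-- `R` is an asymptotic resolvent of the family `S` at `l`: a bounded family such that
`(l I - S_h) R_h → I` and `R_h (l I - S_h) → I` in norm as `h → 0`. -/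
def IsAsympResolvent (S R : ℝ → X →L[ℂ] X) (l : ℂ) : Prop :=
  BddFamily R ∧
  Tendsto (fun h => ‖(l • (1 : X →L[ℂ] X) - S h) * R h - 1‖) zeroFilter (𝓝 0) ∧
  Tendsto (fun h => ‖R h * (l • (1 : X →L[ℂ] X) - S h) - 1‖) zeroFilter (𝓝 0)

/-- The resolvent set of a family of operators. -/
def famResolvent (S : ℝ → X →L[ℂ] X) : Set ℂ :=
  {l : ℂ | ∃ R : ℝ → X →L[ℂ] X, IsAsympResolvent S R l}

/-- The spectrum of a family of operators. -/
def famSpectrum (S : ℝ → X →L[ℂ] X) : Set ℂ :=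
  (famResolvent S)ᶜ

section AsymptoticCommutation

open Asymptotics

variable {α R : Type*} [NormedRing R] {l : Filter α} {S T A : α → R}

theorem isBigO_one_pow (hS : S =O[l] fun _ => (1 : ℝ)) (k : ℕ) :
    (fun h => S h ^ k) =O[l] fun _ => (1 : ℝ) := by
  induction k with
  | zero => simpa using isBigO_const_const (1 : R) (one_ne_zero : (1 : ℝ) ≠ 0) l
  | succ k ih => simpa [pow_succ] using ih.mul hS

theorem isLittleO_pow_commutator (hS : S =O[l] fun _ => (1 : ℝ))
    (hSA : (fun h => S h * A h - A h * S h) =o[l] fun _ => (1 : ℝ)) (k : ℕ) :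
    (fun h => S h ^ k * A h - A h * S h ^ k) =o[l] fun _ => (1 : ℝ) := by
  induction k with
  | zero => simpa using tendsto_const_nhds
  | succ k ih =>
    have h₁ := (isBigO_one_pow hS k).mul_isLittleO hSA
    have h₂ := ih.mul_isBigO hS
    simp only [mul_one] at h₁ h₂
    refine (h₁.add h₂).congr_left fun h => ?_
    rw [pow_succ]
    noncomm_ring

theorem isLittleO_commutator_symm
    (hSA : (fun h => S h * A h - A h * S h) =o[l] fun _ => (1 : ℝ)) :
    (fun h => A h * S h - S h * A h) =o[l] fun _ => (1 : ℝ) :=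
  hSA.neg_left.congr_left fun _ => neg_sub _ _

theorem isLittleO_mul_pow_sub (hS : S =O[l] fun _ => (1 : ℝ)) (hA : A =O[l] fun _ => (1 : ℝ))
    (hSA : (fun h => S h * A h - A h * S h) =o[l] fun _ => (1 : ℝ)) (k : ℕ) :
    (fun h => (S h * A h) ^ k - S h ^ k * A h ^ k) =o[l] fun _ => (1 : ℝ) := by
  induction k with
  | zero => simpa using tendsto_const_nhds
  | succ k ih =>
    have h₁ := (hS.mul hA).mul_isLittleO ih
    have h₂ := (hS.mul_isLittleO (isLittleO_commutator_symm
      (isLittleO_pow_commutator hS hSA k))).mul_isBigO (isBigO_one_pow hA k)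
    simp only [mul_one] at h₁ h₂
    refine (h₁.add h₂).congr_left fun h => ?_
    rw [pow_succ' (S h * A h), pow_succ' (S h), pow_succ' (A h)]
    noncomm_ring

theorem isLittleO_mul_pow_mul_mul_pow_sub (hS : S =O[l] fun _ => (1 : ℝ))
    (hT : T =O[l] fun _ => (1 : ℝ)) (hA : A =O[l] fun _ => (1 : ℝ))
    (hSA : (fun h => S h * A h - A h * S h) =o[l] fun _ => (1 : ℝ))
    (hTA : (fun h => T h * A h - A h * T h) =o[l] fun _ => (1 : ℝ)) (k m : ℕ) :
    (fun h => (S h * A h) ^ k * (T h * A h) ^ m - S h ^ k * T h ^ m * A h ^ (k + m))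
      =o[l] fun _ => (1 : ℝ) := by
  have hcomm := isLittleO_pow_commutator hA
    (isLittleO_commutator_symm (isLittleO_pow_commutator hT hTA m)) k
  have h₁ := (isLittleO_mul_pow_sub hS hA hSA k).mul_isBigO
    (isBigO_one_pow (by simpa using hT.mul hA) m)
  have h₂ := ((isBigO_one_pow hS k).mul (isBigO_one_pow hA k)).mul_isLittleO
    (isLittleO_mul_pow_sub hT hA hTA m)
  have h₃ := ((isBigO_one_pow hS k).mul_isLittleO hcomm).mul_isBigO (isBigO_one_pow hA m)
  simp only [mul_one] at h₁ h₂ h₃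
  refine ((h₁.add h₂).add h₃).congr_left fun h => ?_
  rw [pow_add]
  noncomm_ring

end AsymptoticCommutation

section Bracket

open Asymptotics

variable {α : Type*} {l : Filter α} {S T A : α → X →L[ℂ] X}

theorem isBigO_one_qBr (hS : S =O[l] fun _ => (1 : ℝ)) (hT : T =O[l] fun _ => (1 : ℝ)) (n : ℕ) :
    (fun h => qBr (S h) (T h) n) =O[l] fun _ => (1 : ℝ) := by
  unfold qBr
  refine IsBigO.fun_sum fun k _ => ?_
  simpa using ((isBigO_one_pow hS k).mul (isBigO_one_pow hT (n - k))).const_smul_left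
    ((-1 : ℂ) ^ (n - k) * (n.choose k : ℂ))

theorem isLittleO_qBr_mul_sub (hS : S =O[l] fun _ => (1 : ℝ))
    (hT : T =O[l] fun _ => (1 : ℝ)) (hA : A =O[l] fun _ => (1 : ℝ))
    (hSA : (fun h => S h * A h - A h * S h) =o[l] fun _ => (1 : ℝ))
    (hTA : (fun h => T h * A h - A h * T h) =o[l] fun _ => (1 : ℝ)) (n : ℕ) :
    (fun h => qBr (S h * A h) (T h * A h) n - qBr (S h) (T h) n * A h ^ n)
      =o[l] fun _ => (1 : ℝ) := by
  simp only [qBr, Finset.sum_mul, ← Finset.sum_sub_distrib]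
  refine IsLittleO.fun_sum fun k hk => ?_
  have hkn : k + (n - k) = n := by grind
  have h := isLittleO_mul_pow_mul_mul_pow_sub hS hT hA hSA hTA k (n - k)
  rw [hkn] at h
  refine (h.const_smul_left ((-1 : ℂ) ^ (n - k) * (n.choose k : ℂ))).congr_left fun x => ?_
  rw [Pi.smul_apply, smul_mul_assoc, smul_sub]

theorem limsup_norm_nonneg {E : Type*} [SeminormedAddCommGroup E] [l.NeBot] {f : α → E}
    (hf : f =O[l] fun _ => (1 : ℝ)) : 0 ≤ limsup (fun h => ‖f h‖) l :=
  le_limsup_of_frequently_le (Frequently.of_forall fun _ => norm_nonneg _)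
    ((isBigO_one_iff ℝ).1 hf)

theorem limsup_norm_le_mul_limsup_norm {E F : Type*} [SeminormedAddCommGroup E]
    [SeminormedAddCommGroup F] [l.NeBot]
    {f : α → E} {g : α → F} {r : α → ℝ} {c : ℝ} (hg : g =O[l] fun _ => (1 : ℝ))
    (hr : Tendsto r l (𝓝 0)) (hc : 0 ≤ c) (hle : ∀ᶠ h in l, ‖f h‖ ≤ ‖g h‖ * c + r h) :
    limsup (fun h => ‖f h‖) l ≤ limsup (fun h => ‖g h‖) l * c := by
  set L := limsup (fun h => ‖g h‖) l
  have hε : ∀ ε > 0, limsup (fun h => ‖f h‖) l ≤ (L + ε) * c + ε := by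
    intro ε hε
    have hgL : ∀ᶠ h in l, ‖g h‖ < L + ε :=
      eventually_lt_of_limsup_lt (lt_add_of_pos_right L hε) ((isBigO_one_iff ℝ).1 hg)
    refine limsup_le_of_le
      (isCoboundedUnder_le_of_le l (x := 0) fun _ => norm_nonneg _) ?_
    filter_upwards [hle, hgL, hr.eventually_lt_const hε] with h h₁ h₂ h₃
    nlinarith [mul_le_mul_of_nonneg_right h₂.le hc]
  have hlim : Tendsto (fun ε : ℝ => (L + ε) * c + ε) (𝓝[>] 0) (𝓝 (L * c)) := by
    have hcont : Continuous fun ε : ℝ => (L + ε) * c + ε := by fun_prop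
    simpa using (hcont.tendsto 0).mono_left nhdsWithin_le_nhds
  exact ge_of_tendsto hlim (eventually_mem_nhdsWithin.mono hε)

theorem tendsto_limsup_qBr_mul_rpow [l.NeBot] (hS : S =O[l] fun _ => (1 : ℝ))
    (hT : T =O[l] fun _ => (1 : ℝ)) (hA : A =O[l] fun _ => (1 : ℝ))
    (hSA : (fun h => S h * A h - A h * S h) =o[l] fun _ => (1 : ℝ))
    (hTA : (fun h => T h * A h - A h * T h) =o[l] fun _ => (1 : ℝ))
    (hQN : Tendsto (fun n : ℕ => (limsup (fun h => ‖qBr (S h) (T h) n‖) l) ^ ((n : ℝ)⁻¹))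
      atTop (𝓝 0)) :
    Tendsto (fun n : ℕ =>
      (limsup (fun h => ‖qBr (S h * A h) (T h * A h) n‖) l) ^ ((n : ℝ)⁻¹)) atTop (𝓝 0) := by
  obtain ⟨M, hM, hAM⟩ := hA.exists_nonneg
  have hSA' : (fun h => S h * A h) =O[l] fun _ => (1 : ℝ) := by simpa using hS.mul hA
  have hTA' : (fun h => T h * A h) =O[l] fun _ => (1 : ℝ) := by simpa using hT.mul hA
  have hlim := hQN.mul_const M
  rw [zero_mul] at hlim
  refine squeeze_zero' (Eventually.of_forall fun n =>
    Real.rpow_nonneg (limsup_norm_nonneg (isBigO_one_qBr hSA' hTA' n)) _) ?_ hlim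
  filter_upwards [eventually_gt_atTop 0] with n hn
  have hr := ((isLittleO_one_iff ℝ).1 (isLittleO_qBr_mul_sub hS hT hA hSA hTA n)).norm
  rw [norm_zero] at hr
  have hle : limsup (fun h => ‖qBr (S h * A h) (T h * A h) n‖) l ≤
      limsup (fun h => ‖qBr (S h) (T h) n‖) l * M ^ n := by
    refine limsup_norm_le_mul_limsup_norm (isBigO_one_qBr hS hT n) hr (by positivity) ?_
    filter_upwards [hAM.bound] with h hh
    have hAn : ‖A h ^ n‖ ≤ M ^ n :=
      (norm_pow_le' _ hn).trans (pow_le_pow_left₀ (norm_nonneg _) (by simpa using hh) n)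
    calc ‖qBr (S h * A h) (T h * A h) n‖
        ≤ ‖qBr (S h) (T h) n * A h ^ n‖ +
          ‖qBr (S h * A h) (T h * A h) n - qBr (S h) (T h) n * A h ^ n‖ :=
          norm_le_norm_add_norm_sub' _ _
      _ ≤ _ := by
          gcongr
          exact (norm_mul_le _ _).trans (by gcongr)
  calc _ ≤ (limsup (fun h => ‖qBr (S h) (T h) n‖) l * M ^ n) ^ ((n : ℝ)⁻¹) :=
        Real.rpow_le_rpow (limsup_norm_nonneg (isBigO_one_qBr hSA' hTA' n)) hle (by positivity)
    _ = _ := by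
        rw [Real.mul_rpow (limsup_norm_nonneg (isBigO_one_qBr hS hT n)) (by positivity),
          Real.pow_rpow_inv_natCast hM hn.ne']

end Bracket

instance zeroFilter_neBot : zeroFilter.NeBot :=
  left_nhdsWithin_Ioc_neBot zero_lt_one

theorem BddFamily.isBigO_one {S : ℝ → X →L[ℂ] X} (hS : BddFamily S) :
    S =O[zeroFilter] fun _ => (1 : ℝ) := by
  obtain ⟨M, hM⟩ := hS
  refine Asymptotics.IsBigO.of_bound M ?_
  filter_upwards [show Set.Ioc (0 : ℝ) 1 ∈ zeroFilter from self_mem_nhdsWithin] with h hh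
  simpa using hM h hh

theorem stmt19 {X : Type*} [NormedAddCommGroup X] [NormedSpace ℂ X] [CompleteSpace X]
    (S T A : ℝ → X →L[ℂ] X) (hS : BddFamily S) (hT : BddFamily T) (hA : BddFamily A)
    (hQN : AsympQNEquiv S T)
    (hSA : Tendsto (fun h => ‖S h * A h - A h * S h‖) zeroFilter (𝓝 0))
    (hTA : Tendsto (fun h => ‖T h * A h - A h * T h‖) zeroFilter (𝓝 0)) :
    AsympQNEquiv (fun h => S h * A h) (fun h => T h * A h) := by
  have hSA' := (Asymptotics.isLittleO_one_iff ℝ).2 (tendsto_zero_iff_norm_tendsto_zero.2 hSA)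
  have hTA' := (Asymptotics.isLittleO_one_iff ℝ).2 (tendsto_zero_iff_norm_tendsto_zero.2 hTA)
  exact ⟨tendsto_limsup_qBr_mul_rpow hS.isBigO_one hT.isBigO_one hA.isBigO_one hSA' hTA' hQN.1,
    tendsto_limsup_qBr_mul_rpow hT.isBigO_one hS.isBigO_one hA.isBigO_one hTA' hSA' hQN.2⟩
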